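/- Let K be a commutative semiring, t ≥ 1, and let R be a fence on r₁, …, r_t with weights u_i = w(r_i) (the same weights on every copy of R). Let m ≥ 2, w ≥ 1, 1 ≤ k ≤ m, and set L₀ = (w−1)m + (m−k+1). Take fresh elements σ₁, …, σ_m with weights s₁, …, s_m, and a chain c₁, …, c_{L₀} where c_j carries the weight s_{((k+j−2) mod m)+1} (so the chain runs cyclically through the spoke weights starting at s_k and ending at s_m). Let M, B₁, B₂ be finite posets with distinguished elements μ ∈ M, b₁ ∈ B₁, b₂ ∈ B₂. Define six configurations by generating relations (always including the orders of the tail posets involved and the fence relations of the copy of R involved): P₁ on {σ's} ∪ R ∪ B₁ with σ₁ ≺ σ₂ ≺ ⋯ ≺ σ_m, σ₁ ≺ r₁, r₁ ≺ σ_m, and b₁ ≺ r_t; P₂ on M ∪ {c's} ∪ R ∪ B₂ with c₁ ≺ c₂ ≺ ⋯ ≺ c_{L₀}, c₁ ≺ μ, r₁ ≺ c_{L₀}, and r_t ≺ b₂; P₃ on {σ's} ∪ R ∪ B₂ with the σ-chain, σ₁ ≺ r₁, r₁ ≺ σ_m, and r_t ≺ b₂; P₄ on M ∪ {c's} ∪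 R ∪ B₁ with the c-chain, c₁ ≺ μ, r₁ ≺ c_{L₀}, and b₁ ≺ r_t; P₅ on M ∪ {σ's} with the cyclic chain σ_k ≺ σ_{k+1} ≺ ⋯ ≺ σ_{k−1} (all m spokes, indices taken modulo m in {1, …, m}), σ_k ≺ μ, and μ ≺ σ_{k−1}; P₆ on B₁ ∪ B₂ with b₂ ≺ b₁. Then Z(P₁) · Z(P₂) = Z(P₃) · Z(P₄) + (∏_{i=1}^{t} u_i) · Z(P₅) · Z(P₆). -/

import Mathlib

/-!
The combinatorial content of Case iii of Proposition 5.1 of the paper (Type 0 crossing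
with `s = 1` and `s(γ₁)` notched), in the down-set formalism: `γ₁` is notched at a
puncture with spokes `σ₁, …, σ_m` attached as a loop at the start of its overlap fence
`R`, while `γ₂` first crosses a chain of spokes (winding `w − 1` extra times around the
puncture, recorded by `c₁, …, c_{L₀}` with cyclic weights starting at `s_k` and ending
at `s_m`) before crossing `R`; the skein relation reads
`Z(P₁) · Z(P₂) = Z(P₃) · Z(P₄) + (∏ u_i) · Z(P₅) · Z(P₆)`.
(The winding number `w` of the statement is called `W` here, to avoid a clash with the
weight function.)
-/

attribute [local instance] Classical.propDecidable

noncomputable section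

/-- The ideal sum of a configuration: the sum, over all down-sets `S` of the ground set
(`S ⊆ ground`, closed under the generating relations: `rel x y` with `x ∈ ground` and
`y ∈ S` implies `x ∈ S`), of the product of the weights of the elements of `S`. -/
def idealSum {α K : Type*} [CommSemiring K]
    (ground : Finset α) (rel : α → α → Prop) (w : α → K) : K :=
  ∑ S ∈ ground.powerset.filter
      (fun S => ∀ x ∈ ground, ∀ y ∈ S, rel x y → x ∈ S),
    ∏ x ∈ S, w x

/-- The generating chain `f lo ≺ f (lo+1) ≺ ⋯ ≺ f hi`. -/
def chainRel {α : Type*} (f : ℕ → α) (lo hi : ℕ) : α → α → Prop :=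
  fun p q => ∃ i, lo ≤ i ∧ i + 1 ≤ hi ∧ p = f i ∧ q = f (i + 1)

/-- The single generating relation `u ≺ v`. -/
def covRel {α : Type*} (u v : α) : α → α → Prop := fun p q => p = u ∧ q = v

/-- The order of a poset `P`, transported along `f`. -/
def posetRel {P α : Type*} [PartialOrder P] (f : P → α) : α → α → Prop :=
  fun p q => ∃ x y : P, x ≤ y ∧ p = f x ∧ q = f y

/-- A fence on `f 1, …, f t`: for each `1 ≤ i < t` one chosen generating relation,
either `f i ≺ f (i+1)` (when `ε i = true`) or `f (i+1) ≺ f i` (when `ε i = false`). -/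
def fenceRel {α : Type*} (f : ℕ → α) (t : ℕ) (ε : ℕ → Bool) : α → α → Prop :=
  fun p q => ∃ i, 1 ≤ i ∧ i + 1 ≤ t ∧
    ((ε i = true ∧ p = f i ∧ q = f (i + 1)) ∨
     (ε i = false ∧ p = f (i + 1) ∧ q = f i))

/-- The elements `f lo, …, f hi`. -/
def natGround {α : Type*} (f : ℕ → α) (lo hi : ℕ) : Finset α := (Finset.Icc lo hi).image f

/-- All the elements of the finite poset `P`, transported along `f`. -/
def posetGround {P α : Type*} [Fintype P] (f : P → α) : Finset α := Finset.univ.image f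

/-- Embedding of the tail poset `M`. -/
def eM (M B₁ B₂ : Type*) : M → M ⊕ (B₁ ⊕ (B₂ ⊕ (ℕ ⊕ (ℕ ⊕ ℕ)))) := Sum.inl

/-- Embedding of the tail poset `B₁`. -/
def eB1 (M B₁ B₂ : Type*) : B₁ → M ⊕ (B₁ ⊕ (B₂ ⊕ (ℕ ⊕ (ℕ ⊕ ℕ)))) :=
  fun y => Sum.inr (Sum.inl y)

/-- Embedding of the tail poset `B₂`. -/
def eB2 (M B₁ B₂ : Type*) : B₂ → M ⊕ (B₁ ⊕ (B₂ ⊕ (ℕ ⊕ (ℕ ⊕ ℕ)))) :=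
  fun y => Sum.inr (Sum.inr (Sum.inl y))

/-- The fence elements `r₁, …, r_t` of the overlap `R`. -/
def eR (M B₁ B₂ : Type*) : ℕ → M ⊕ (B₁ ⊕ (B₂ ⊕ (ℕ ⊕ (ℕ ⊕ ℕ)))) :=
  fun i => Sum.inr (Sum.inr (Sum.inr (Sum.inl i)))

/-- The spokes `σ₁, …, σ_m`. -/
def eS (M B₁ B₂ : Type*) : ℕ → M ⊕ (B₁ ⊕ (B₂ ⊕ (ℕ ⊕ (ℕ ⊕ ℕ)))) :=
  fun i => Sum.inr (Sum.inr (Sum.inr (Sum.inr (Sum.inl i))))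

/-- The chain elements `c₁, …, c_{L₀}`. -/
def eC (M B₁ B₂ : Type*) : ℕ → M ⊕ (B₁ ⊕ (B₂ ⊕ (ℕ ⊕ (ℕ ⊕ ℕ)))) :=
  fun j => Sum.inr (Sum.inr (Sum.inr (Sum.inr (Sum.inr j))))

/-- The sum, over the subsets `S` of `G` satisfying `P`, of the product of the weights of the
elements of `S`. -/
def subsetSum {α K : Type*} [CommSemiring K] (G : Finset α) (P : Finset α → Prop) (w : α → K) :
    K :=
  ∑ S ∈ G.powerset with P S, ∏ x ∈ S, w x

/-- `S` is closed under the generating relations `rel` on `G`. -/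
def IsDown {α : Type*} (G : Finset α) (rel : α → α → Prop) (S : Finset α) : Prop :=
  ∀ x ∈ G, ∀ y ∈ S, rel x y → x ∈ S

/-- `S` is closed under the chain `f 1 ≺ ⋯ ≺ f n`. -/
def ChainDown {α : Type*} (f : ℕ → α) (n : ℕ) (S : Finset α) : Prop :=
  ∀ i, 1 ≤ i → i + 1 ≤ n → f (i + 1) ∈ S → f i ∈ S

/-- `S` is closed under the fence relations on `f 1, …, f t`. -/
def FenceDown {α : Type*} (f : ℕ → α) (t : ℕ) (ε : ℕ → Bool) (S : Finset α) : Prop :=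
  ∀ i, 1 ≤ i → i + 1 ≤ t →
    (ε i = true → f (i + 1) ∈ S → f i ∈ S) ∧ (ε i = false → f i ∈ S → f (i + 1) ∈ S)

/-- `S` is closed under the order of the poset `P`, transported along `f`. -/
def PosetDown {P α : Type*} [PartialOrder P] (f : P → α) (S : Finset α) : Prop :=
  ∀ x y, x ≤ y → f y ∈ S → f x ∈ S

section Closure

variable {α : Type*} {G S : Finset α}

theorem isDown_sup {r r' : α → α → Prop} :
    IsDown G (r ⊔ r') S ↔ IsDown G r S ∧ IsDown G r' S := by
  refine ⟨fun h => ⟨fun x hx y hy hr => h x hx y hy (Or.inl hr),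
    fun x hx y hy hr => h x hx y hy (Or.inr hr)⟩, ?_⟩
  rintro ⟨h, h'⟩ x hx y hy (hr | hr)
  exacts [h x hx y hy hr, h' x hx y hy hr]

theorem isDown_covRel {u v : α} (hu : u ∈ G) : IsDown G (covRel u v) S ↔ (v ∈ S → u ∈ S) := by
  refine ⟨fun h hv => h u hu v hv ⟨rfl, rfl⟩, ?_⟩
  rintro h x - y hy ⟨rfl, rfl⟩
  exact h hy

theorem mem_natGround {f : ℕ → α} {lo hi i : ℕ} (h₁ : lo ≤ i) (h₂ : i ≤ hi) :
    f i ∈ natGround f lo hi :=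
  Finset.mem_image_of_mem _ (Finset.mem_Icc.2 ⟨h₁, h₂⟩)

theorem mem_posetGround {P : Type*} [Fintype P] (f : P → α) (x : P) : f x ∈ posetGround f :=
  Finset.mem_image_of_mem _ (Finset.mem_univ x)

theorem isDown_chainRel {f : ℕ → α} {n : ℕ} (hG : natGround f 1 n ⊆ G) :
    IsDown G (chainRel f 1 n) S ↔ ChainDown f n S := by
  refine ⟨fun h i h₁ h₂ hi => h _ (hG (mem_natGround h₁ (by lia))) _ hi ⟨i, h₁, h₂, rfl, rfl⟩, ?_⟩
  rintro h x - y hy ⟨i, h₁, h₂, rfl, rfl⟩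
  exact h i h₁ h₂ hy

theorem isDown_fenceRel {f : ℕ → α} {t : ℕ} {ε : ℕ → Bool} (hG : natGround f 1 t ⊆ G) :
    IsDown G (fenceRel f t ε) S ↔ FenceDown f t ε S := by
  refine ⟨fun h i h₁ h₂ => ⟨fun e hi => ?_, fun e hi => ?_⟩, ?_⟩
  · exact h _ (hG (mem_natGround h₁ (by lia))) _ hi ⟨i, h₁, h₂, Or.inl ⟨e, rfl, rfl⟩⟩
  · exact h _ (hG (mem_natGround (by lia) h₂)) _ hi ⟨i, h₁, h₂, Or.inr ⟨e, rfl, rfl⟩⟩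
  · rintro h x - y hy ⟨i, h₁, h₂, ⟨e, rfl, rfl⟩ | ⟨e, rfl, rfl⟩⟩
    exacts [(h i h₁ h₂).1 e hy, (h i h₁ h₂).2 e hy]

theorem isDown_posetRel {P : Type*} [Fintype P] [PartialOrder P] {f : P → α}
    (hG : posetGround f ⊆ G) : IsDown G (posetRel f) S ↔ PosetDown f S := by
  refine ⟨fun h x y hxy hy => h _ (hG (mem_posetGround f x)) _ hy
    ⟨x, y, hxy, rfl, rfl⟩, ?_⟩
  rintro h _ - _ hy ⟨x, y, hxy, rfl, rfl⟩
  exact h x y hxy hy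

end Closure

section SubsetSum

variable {α K : Type*} [CommSemiring K] {w : α → K}

theorem idealSum_eq_subsetSum (G : Finset α) (rel : α → α → Prop) (w : α → K) :
    idealSum G rel w = subsetSum G (IsDown G rel) w := by
  unfold idealSum subsetSum IsDown
  congr

theorem subsetSum_congr {G : Finset α} {P Q : Finset α → Prop} (h : ∀ S ⊆ G, (P S ↔ Q S)) :
    subsetSum G P w = subsetSum G Q w := by
  unfold subsetSum
  congr 1
  ext S
  simp only [Finset.mem_filter, Finset.mem_powerset]
  exact ⟨fun hS => ⟨hS.1, (h S hS.1).1 hS.2⟩, fun hS => ⟨hS.1, (h S hS.1).2 hS.2⟩⟩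

theorem subsetSum_eq_add (G : Finset α) (P Q : Finset α → Prop) (w : α → K) :
    subsetSum G P w =
      subsetSum G (fun S => P S ∧ Q S) w + subsetSum G (fun S => P S ∧ ¬ Q S) w := by
  unfold subsetSum
  rw [← Finset.sum_filter_add_sum_filter_not _ Q, Finset.filter_filter, Finset.filter_filter]
  congr

theorem subsetSum_union_prod [DecidableEq α] {G H : Finset α} (hGH : Disjoint G H)
    {P PG PH : Finset α → Prop}
    (h : ∀ S ⊆ G, ∀ T ⊆ H, (P (S ∪ T) ↔ PG S ∧ PH T)) :
    subsetSum (G ∪ H) P w = subsetSum G PG w * subsetSum H PH w := by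
  unfold subsetSum
  rw [Finset.sum_mul_sum, ← Finset.sum_product']
  symm
  have hd : ∀ S ⊆ G, ∀ T ⊆ H, (S ∪ T) ∩ G = S ∧ (S ∪ T) ∩ H = T := by
    intro S hS T hT
    have h₁ := Finset.disjoint_left.1 hGH
    constructor <;> ext x <;> simp only [Finset.mem_inter, Finset.mem_union] <;>
      have h₂ := @hS x <;> have h₃ := @hT x <;> have h₄ := @h₁ x <;> tauto
  refine Finset.sum_bij' (fun p _ => p.1 ∪ p.2) (fun S _ => (S ∩ G, S ∩ H)) ?_ ?_ ?_ ?_ ?_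
  · rintro ⟨S, T⟩ hST
    simp only [Finset.mem_product, Finset.mem_filter, Finset.mem_powerset] at hST ⊢
    exact ⟨Finset.union_subset_union hST.1.1 hST.2.1,
      (h S hST.1.1 T hST.2.1).2 ⟨hST.1.2, hST.2.2⟩⟩
  · intro S hS
    simp only [Finset.mem_product, Finset.mem_filter, Finset.mem_powerset] at hS ⊢
    have e : S ∩ G ∪ S ∩ H = S := by
      rw [← Finset.inter_union_distrib_left, Finset.inter_eq_left.2 hS.1]
    have := (h (S ∩ G) Finset.inter_subset_right (S ∩ H) Finset.inter_subset_right).1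
      (by rw [e]; exact hS.2)
    exact ⟨⟨Finset.inter_subset_right, this.1⟩, Finset.inter_subset_right, this.2⟩
  · rintro ⟨S, T⟩ hST
    simp only [Finset.mem_product, Finset.mem_filter, Finset.mem_powerset] at hST
    have := hd S hST.1.1 T hST.2.1
    exact Prod.ext this.1 this.2
  · intro S hS
    simp only [Finset.mem_filter, Finset.mem_powerset] at hS
    exact (Finset.inter_union_distrib_left _ _ _).symm.trans (Finset.inter_eq_left.2 hS.1)
  · rintro ⟨S, T⟩ hST
    simp only [Finset.mem_product, Finset.mem_filter, Finset.mem_powerset] at hST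
    exact (Finset.prod_union (Finset.disjoint_of_subset_left hST.1.1
      (Finset.disjoint_of_subset_right hST.2.1 hGH))).symm

/-- Gluing two disjoint blocks along the state of one element `q` of the second block. -/
theorem subsetSum_union [DecidableEq α] {G H : Finset α} (hGH : Disjoint G H) {q : α} (hq : q ∈ H)
    {P PH : Finset α → Prop} {PG : Prop → Finset α → Prop}
    (h : ∀ S ⊆ G, ∀ T ⊆ H, (P (S ∪ T) ↔ PG (q ∈ T) S ∧ PH T)) :
    subsetSum (G ∪ H) P w =
      subsetSum G (PG True) w * subsetSum H (fun T => PH T ∧ q ∈ T) w +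
        subsetSum G (PG False) w * subsetSum H (fun T => PH T ∧ q ∉ T) w := by
  have hm : ∀ S ⊆ G, ∀ T : Finset α, (q ∈ S ∪ T ↔ q ∈ T) := fun S hS T => by
    have := Finset.disjoint_right.1 hGH hq
    simp only [Finset.mem_union, or_iff_right_iff_imp]
    exact fun hqS => (this (hS hqS)).elim
  rw [subsetSum_eq_add _ _ (q ∈ ·)]
  congr 1
  · refine subsetSum_union_prod hGH fun S hS T hT => ?_
    rw [h S hS T hT, hm S hS]
    by_cases hqT : q ∈ T <;> simp [hqT]
  · refine subsetSum_union_prod hGH fun S hS T hT => ?_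
    rw [h S hS T hT, hm S hS]
    by_cases hqT : q ∈ T <;> simp [hqT]

/-- Gluing three disjoint blocks, the middle one having the two interface elements `p`, `q`. -/
theorem subsetSum_union_three [DecidableEq α] {G R H : Finset α}
    (hGR : Disjoint G R) (hGH : Disjoint G H)
    (hRH : Disjoint R H) {p q : α} (hp : p ∈ R) (hq : q ∈ R)
    {P PR : Finset α → Prop} {PG PH : Prop → Finset α → Prop}
    (h : ∀ S ⊆ G, ∀ T ⊆ R, ∀ V ⊆ H,
      (P (S ∪ T ∪ V) ↔ PG (p ∈ T) S ∧ PR T ∧ PH (q ∈ T) V)) :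
    subsetSum (G ∪ R ∪ H) P w =
      (subsetSum G (PG False) w * subsetSum R (fun T => (PR T ∧ q ∉ T) ∧ p ∉ T) w +
        subsetSum G (PG True) w * subsetSum R (fun T => (PR T ∧ q ∉ T) ∧ p ∈ T) w) *
          subsetSum H (PH False) w +
      (subsetSum G (PG False) w * subsetSum R (fun T => (PR T ∧ q ∈ T) ∧ p ∉ T) w +
        subsetSum G (PG True) w * subsetSum R (fun T => (PR T ∧ q ∈ T) ∧ p ∈ T) w) *
          subsetSum H (PH True) w := by
  have hm : ∀ S ⊆ G, ∀ T : Finset α, (q ∈ S ∪ T ↔ q ∈ T) := fun S hS T => by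
    have := Finset.disjoint_right.1 hGR hq
    simp only [Finset.mem_union, or_iff_right_iff_imp]
    exact fun hqS => (this (hS hqS)).elim
  have hinter : ∀ S ⊆ G, ∀ T ⊆ R, (S ∪ T) ∩ G = S ∧ (S ∪ T) ∩ R = T := by
    intro S hS T hT
    have h₁ := Finset.disjoint_left.1 hGR
    constructor <;> ext x <;> simp only [Finset.mem_inter, Finset.mem_union] <;>
      have h₂ := @hS x <;> have h₃ := @hT x <;> have h₄ := @h₁ x <;> tauto
  have hsplit : ∀ U ⊆ G ∪ R, U = U ∩ G ∪ U ∩ R := fun U hU => by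
    rw [← Finset.inter_union_distrib_left, Finset.inter_eq_left.2 hU]
  rw [Finset.union_comm (G ∪ R) H,
    subsetSum_union (q := q) (PG := PH)
      (PH := fun U => PG (p ∈ U ∩ R) (U ∩ G) ∧ PR (U ∩ R))
      (Finset.disjoint_union_right.2 ⟨hGH.symm, hRH.symm⟩) (Finset.mem_union_right _ hq),
    subsetSum_union (q := p) (PG := PG) (PH := fun T => PR T ∧ q ∈ T) hGR hp,
    subsetSum_union (q := p) (PG := PG) (PH := fun T => PR T ∧ q ∉ T) hGR hp]
  · ring
  · intro S hS T hT
    rw [(hinter S hS T hT).1, (hinter S hS T hT).2, hm S hS, and_assoc]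
  · intro S hS T hT
    rw [(hinter S hS T hT).1, (hinter S hS T hT).2, hm S hS, and_assoc]
  · intro V hV U hU
    have hqU : q ∈ U ∩ R ↔ q ∈ U := by simp [hq]
    have := h (U ∩ G) Finset.inter_subset_right (U ∩ R) Finset.inter_subset_right V hV
    rw [← hsplit U hU, hqU] at this
    rw [Finset.union_comm V U, this]
    tauto

end SubsetSum

section Chain

variable {α K : Type*} [CommSemiring K] {w : α → K}

/-- The down-sets of a chain are its initial segments. -/
theorem subsetSum_chain {f : ℕ → α} {n : ℕ} (hf : Set.InjOn f (Set.Icc 1 n)) (hn : 1 ≤ n)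
    (a b : Prop) :
    subsetSum (natGround f 1 n)
        (fun S => ChainDown f n S ∧ (a → f 1 ∈ S) ∧ (f n ∈ S → b)) w =
      ∑ j ∈ Finset.range (n + 1) with (a → 1 ≤ j) ∧ (j = n → b),
        ∏ i ∈ Finset.range j, w (f (i + 1)) := by
  have hmem : ∀ j ≤ n, ∀ i, 1 ≤ i → i ≤ n → (f i ∈ natGround f 1 j ↔ i ≤ j) := by
    intro j hj i h₁ h₂
    refine ⟨fun h => ?_, fun h => mem_natGround h₁ h⟩
    obtain ⟨i', hi', e⟩ := Finset.mem_image.1 h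
    rw [Finset.mem_Icc] at hi'
    have := hf ⟨hi'.1, hi'.2.trans hj⟩ ⟨h₁, h₂⟩ e
    lia
  symm
  unfold subsetSum
  refine Finset.sum_bij (fun j _ => natGround f 1 j) ?_ ?_ ?_ ?_
  · intro j hj
    simp only [Finset.mem_filter, Finset.mem_range, Finset.mem_powerset] at hj ⊢
    have hjn : j ≤ n := by lia
    refine ⟨Finset.image_subset_image (Finset.Icc_subset_Icc_right hjn), ?_, ?_, ?_⟩
    · intro i h₁ h₂
      rw [hmem j hjn i h₁ (by lia), hmem j hjn (i + 1) (by lia) h₂]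
      lia
    · rw [hmem j hjn 1 le_rfl hn]
      exact hj.2.1
    · rw [hmem j hjn n hn le_rfl]
      exact fun h => hj.2.2 (le_antisymm hjn h)
  · intro j hj j' hj' e
    simp only [Finset.mem_filter, Finset.mem_range] at hj hj'
    by_contra hne
    rcases Nat.lt_or_gt_of_ne hne with hlt | hlt
    · have h₁ := hmem j (by lia) j' (by lia) (by lia)
      rw [e, hmem j' (by lia) j' (by lia) (by lia)] at h₁
      lia
    · have h₁ := hmem j (by lia) j (by lia) (by lia)
      rw [e, hmem j' (by lia) j (by lia) (by lia)] at h₁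
      lia
  · intro S hS
    simp only [Finset.mem_filter, Finset.mem_powerset] at hS
    obtain ⟨hSG, hch, ha, hb⟩ := hS
    have key : ∃ j ≤ n, ∀ i, 1 ≤ i → i ≤ n → (f i ∈ S ↔ i ≤ j) := by
      have hdown : ∀ i d, 1 ≤ i → i + d ≤ n → f (i + d) ∈ S → f i ∈ S := by
        intro i d h₁
        induction d with
        | zero => exact fun _ h => h
        | succ d ih => exact fun h₂ h => ih (by lia) (hch (i + d) (by lia) h₂ h)
      by_cases hne : ∃ i, 1 ≤ i ∧ i ≤ n ∧ f i ∉ S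
      · refine ⟨Nat.find hne - 1, ?_, ?_⟩
        · have := Nat.find_spec hne
          lia
        · intro i h₁ h₂
          have hspec := Nat.find_spec hne
          constructor
          · intro hi
            by_contra hlt
            obtain ⟨d, rfl⟩ : ∃ d, i = Nat.find hne + d := ⟨i - Nat.find hne, by lia⟩
            exact hspec.2.2 (hdown _ d hspec.1 h₂ hi)
          · intro hi
            by_contra hiS
            have := Nat.find_min hne (m := i) (by lia)
            exact this ⟨h₁, h₂, hiS⟩
      · push Not at hne
        exact ⟨n, le_rfl, fun i h₁ h₂ => ⟨fun _ => h₂, fun _ => hne i h₁ h₂⟩⟩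
    obtain ⟨j, hjn, hj⟩ := key
    refine ⟨j, ?_, ?_⟩
    · simp only [Finset.mem_filter, Finset.mem_range]
      exact ⟨by lia, fun h => (hj 1 le_rfl hn).1 (ha h),
        fun h => hb ((hj n hn le_rfl).2 h.ge)⟩
    · ext x
      constructor
      · intro hx
        obtain ⟨i, hi, rfl⟩ := Finset.mem_image.1 hx
        rw [Finset.mem_Icc] at hi
        exact (hj i hi.1 (hi.2.trans hjn)).2 hi.2
      · intro hx
        obtain ⟨i, hi, rfl⟩ := Finset.mem_image.1 (hSG hx)
        rw [Finset.mem_Icc] at hi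
        exact mem_natGround hi.1 ((hj i hi.1 hi.2).1 hx)
  · intro j hj
    simp only [Finset.mem_filter, Finset.mem_range] at hj
    rw [natGround, Finset.prod_image, ← Finset.Ico_add_one_right_eq_Icc,
      Finset.prod_Ico_eq_prod_range]
    · simp [add_comm]
    · intro x hx y hy
      simp only [Finset.coe_Icc, Set.mem_Icc] at hx hy
      exact hf ⟨hx.1, by lia⟩ ⟨hy.1, by lia⟩

theorem sum_filter_false_false (p : ℕ → K) (n : ℕ)
    {_ : DecidablePred fun j : ℕ => (False → 1 ≤ j) ∧ (j = n → False)} :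
    ∑ j ∈ Finset.range (n + 1) with (False → 1 ≤ j) ∧ (j = n → False), p j =
      ∑ j ∈ Finset.range n, p j := by
  congr 1
  ext j
  simp
  lia

theorem sum_filter_false_true (p : ℕ → K) (n : ℕ)
    {_ : DecidablePred fun j : ℕ => (False → 1 ≤ j) ∧ (j = n → True)} :
    ∑ j ∈ Finset.range (n + 1) with (False → 1 ≤ j) ∧ (j = n → True), p j =
      ∑ j ∈ Finset.range (n + 1), p j := by
  congr 1
  ext j
  simp

theorem sum_filter_true_true (p : ℕ → K) (n : ℕ)
    {_ : DecidablePred fun j : ℕ => (True → 1 ≤ j) ∧ (j = n → True)} :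
    ∑ j ∈ Finset.range (n + 1) with (True → 1 ≤ j) ∧ (j = n → True), p j =
      ∑ j ∈ Finset.range n, p (j + 1) := by
  rw [Finset.sum_filter, Finset.sum_range_succ']
  simp

theorem sum_filter_true_false (p : ℕ → K) (n : ℕ)
    {_ : DecidablePred fun j : ℕ => (True → 1 ≤ j) ∧ (j = n + 1 → False)} :
    ∑ j ∈ Finset.range (n + 1 + 1) with (True → 1 ≤ j) ∧ (j = n + 1 → False), p j =
      ∑ j ∈ Finset.range n, p (j + 1) := by
  rw [Finset.sum_filter, Finset.sum_range_succ', Finset.sum_range_succ]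
  simp only [forall_const, Nat.le_add_left, Nat.add_right_cancel_iff, imp_false, true_and,
    if_false, add_zero, Nat.le_zero_eq, one_ne_zero, false_and]
  refine Finset.sum_congr rfl fun j hj => if_pos (Finset.mem_range.1 hj).ne

end Chain

section Fence

variable {α K : Type*} [CommSemiring K] {w : α → K}

theorem natGround_succ (f : ℕ → α) (n : ℕ) :
    natGround f 1 (n + 1) = natGround f 1 n ∪ {f (n + 1)} := by
  ext x
  simp only [natGround, Finset.mem_image, Finset.mem_Icc, Finset.mem_union, Finset.mem_singleton]
  constructor
  · rintro ⟨i, ⟨h₁, h₂⟩, rfl⟩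
    rcases Nat.lt_or_ge n i with h | h
    · exact Or.inr (by rw [show i = n + 1 by lia])
    · exact Or.inl ⟨i, ⟨h₁, h⟩, rfl⟩
  · rintro (⟨i, ⟨h₁, h₂⟩, rfl⟩ | rfl)
    exacts [⟨i, ⟨h₁, by lia⟩, rfl⟩, ⟨n + 1, ⟨by lia, le_rfl⟩, rfl⟩]

theorem subsetSum_singleton_mem (x : α) (P : Finset α → Prop) (h : P {x}) :
    subsetSum {x} (fun T => P T ∧ x ∈ T) w = w x := by
  unfold subsetSum
  rw [Finset.sum_filter, ← insert_empty_eq x, Finset.sum_powerset_insert (Finset.notMem_empty x)]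
  simp [h]

theorem subsetSum_singleton_notMem (x : α) (P : Finset α → Prop) (h : P ∅) :
    subsetSum {x} (fun T => P T ∧ x ∉ T) w = 1 := by
  unfold subsetSum
  rw [Finset.sum_filter, ← insert_empty_eq x, Finset.sum_powerset_insert (Finset.notMem_empty x)]
  simp [h]

/-- The transfer matrix of a fence has determinant the product of the weights. -/
theorem fence_det {f : ℕ → α} (hf : Function.Injective f) (ε : ℕ → Bool) (t : ℕ) (ht : 1 ≤ t) :
    subsetSum (natGround f 1 t) (fun T => (FenceDown f t ε T ∧ f t ∉ T) ∧ f 1 ∉ T) w *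
        subsetSum (natGround f 1 t) (fun T => (FenceDown f t ε T ∧ f t ∈ T) ∧ f 1 ∈ T) w =
      subsetSum (natGround f 1 t) (fun T => (FenceDown f t ε T ∧ f t ∉ T) ∧ f 1 ∈ T) w *
        subsetSum (natGround f 1 t) (fun T => (FenceDown f t ε T ∧ f t ∈ T) ∧ f 1 ∉ T) w +
      ∏ i ∈ Finset.Icc 1 t, w (f i) := by
  induction t, ht using Nat.le_induction with
  | base =>
    have h₀ : natGround f 1 1 = {f 1} := by simp [natGround]
    have hd : ∀ T, FenceDown f 1 ε T := fun T i _ _ => by lia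
    have e₁ : subsetSum {f 1} (fun T => (FenceDown f 1 ε T ∧ f 1 ∉ T) ∧ f 1 ∈ T) w = 0 := by
      refine Finset.sum_eq_zero fun T hT => ?_
      simp only [Finset.mem_filter] at hT
      exact (hT.2.1.2 hT.2.2).elim
    rw [h₀, e₁, subsetSum_singleton_notMem (f 1) _ (by simp [hd]),
      subsetSum_singleton_mem (f 1) _ (by simp [hd])]
    simp
  | succ t ht ih =>
    have hdisj : Disjoint (natGround f 1 t) {f (t + 1)} := by
      simp only [natGround, Finset.disjoint_singleton_right, Finset.mem_image, Finset.mem_Icc,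
        not_exists]
      rintro i ⟨hi, e⟩
      have := hf e
      lia
    have hmem : ∀ S ⊆ natGround f 1 t, f (t + 1) ∉ S := fun S hS h =>
      Finset.disjoint_singleton_right.1 hdisj (hS h)
    have hlow : ∀ S : Finset α, ∀ T ⊆ ({f (t + 1)} : Finset α), ∀ i ≤ t,
        (f i ∈ S ∪ T ↔ f i ∈ S) := by
      intro S T hT i hi
      simp only [Finset.mem_union, or_iff_left_iff_imp]
      intro h
      have := hf (Finset.mem_singleton.1 (hT h))
      lia
    have hrec : ∀ S ⊆ natGround f 1 t, ∀ T ⊆ {f (t + 1)},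
        (FenceDown f (t + 1) ε (S ∪ T) ↔ FenceDown f t ε S ∧
          (ε t = true → f (t + 1) ∈ T → f t ∈ S) ∧ (ε t = false → f t ∈ S → f (t + 1) ∈ T)) := by
      intro S hS T hT
      have hlast : f (t + 1) ∈ S ∪ T ↔ f (t + 1) ∈ T := by
        simp [hmem S hS]
      constructor
      · intro h
        refine ⟨fun i h₁ h₂ => ?_, ?_⟩
        · have := h i h₁ (by lia)
          rwa [hlow S T hT i (by lia), hlow S T hT (i + 1) h₂] at this
        · have := h t ht le_rfl
          rwa [hlow S T hT t le_rfl, hlast] at this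
      · rintro ⟨h, h'⟩ i h₁ h₂
        rcases Nat.lt_or_ge t (i + 1) with hi | hi
        · obtain rfl : i = t := by lia
          rwa [hlow S T hT i le_rfl, hlast]
        · rw [hlow S T hT i (by lia), hlow S T hT (i + 1) hi]
          exact h i h₁ hi
    have hin : ∀ c : Finset α → Prop,
        (∀ S : Finset α, ∀ T ⊆ ({f (t + 1)} : Finset α), (c (S ∪ T) ↔ c S)) →
        subsetSum (natGround f 1 (t + 1))
          (fun T => (FenceDown f (t + 1) ε T ∧ f (t + 1) ∈ T) ∧ c T) w =
        subsetSum (natGround f 1 t)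
          (fun S => (FenceDown f t ε S ∧ c S) ∧ (ε t = true → f t ∈ S)) w * w (f (t + 1)) := by
      intro c hc
      rw [natGround_succ, subsetSum_union_prod hdisj
        (PG := fun S => (FenceDown f t ε S ∧ c S) ∧ (ε t = true → f t ∈ S))
        (PH := fun T => True ∧ f (t + 1) ∈ T), subsetSum_singleton_mem _ _ trivial]
      intro S hS T hT
      rw [hrec S hS T hT, hc S T hT, Finset.mem_union]
      have := hmem S hS
      tauto
    have hout : ∀ c : Finset α → Prop,
        (∀ S : Finset α, ∀ T ⊆ ({f (t + 1)} : Finset α), (c (S ∪ T) ↔ c S)) →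
        subsetSum (natGround f 1 (t + 1))
          (fun T => (FenceDown f (t + 1) ε T ∧ f (t + 1) ∉ T) ∧ c T) w =
        subsetSum (natGround f 1 t)
          (fun S => (FenceDown f t ε S ∧ c S) ∧ (ε t = false → f t ∉ S)) w := by
      intro c hc
      rw [natGround_succ, subsetSum_union_prod hdisj
        (PG := fun S => (FenceDown f t ε S ∧ c S) ∧ (ε t = false → f t ∉ S))
        (PH := fun T => True ∧ f (t + 1) ∉ T), subsetSum_singleton_notMem _ _ trivial, mul_one]
      intro S hS T hT
      rw [hrec S hS T hT, hc S T hT, Finset.mem_union]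
      have := hmem S hS
      tauto
    have hc₁ : ∀ S : Finset α, ∀ T ⊆ ({f (t + 1)} : Finset α), (f 1 ∈ S ∪ T ↔ f 1 ∈ S) :=
      fun S T hT => hlow S T hT 1 ht
    have hc₀ : ∀ S : Finset α, ∀ T ⊆ ({f (t + 1)} : Finset α), (f 1 ∉ S ∪ T ↔ f 1 ∉ S) :=
      fun S T hT => (hc₁ S T hT).not
    have hall : ∀ c : Finset α → Prop,
        subsetSum (natGround f 1 t) (fun S => FenceDown f t ε S ∧ c S) w =
          subsetSum (natGround f 1 t) (fun S => (FenceDown f t ε S ∧ f t ∈ S) ∧ c S) w +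
          subsetSum (natGround f 1 t) (fun S => (FenceDown f t ε S ∧ f t ∉ S) ∧ c S) w := by
      intro c
      rw [subsetSum_eq_add _ _ (f t ∈ ·)]
      congr 1 <;> exact subsetSum_congr fun S _ => and_right_comm
    rw [hin (f 1 ∈ ·) hc₁, hin (f 1 ∉ ·) hc₀, hout (f 1 ∈ ·) hc₁, hout (f 1 ∉ ·) hc₀,
      Finset.prod_Icc_succ_top (by lia)]
    cases hε : ε t
    · simp only [reduceCtorEq, false_imp_iff, and_true, forall_const]
      rw [hall (f 1 ∈ ·), hall (f 1 ∉ ·)]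
      have hN : ∀ c : Finset α → Prop,
          subsetSum (natGround f 1 t) (fun S => (FenceDown f t ε S ∧ c S) ∧ f t ∉ S) w =
          subsetSum (natGround f 1 t) (fun S => (FenceDown f t ε S ∧ f t ∉ S) ∧ c S) w :=
        fun c => subsetSum_congr fun S _ => and_right_comm
      rw [hN (f 1 ∈ ·), hN (f 1 ∉ ·)]
      refine Eq.trans ?_ ((congrArg (fun x => (x +
        subsetSum (natGround f 1 t) (fun T => (FenceDown f t ε T ∧ f t ∉ T) ∧ f 1 ∈ T) w *
        subsetSum (natGround f 1 t) (fun T => (FenceDown f t ε T ∧ f t ∉ T) ∧ f 1 ∉ T) w) *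
          w (f (t + 1))) ih).trans ?_) <;> ring
    · simp only [reduceCtorEq, false_imp_iff, and_true, forall_const]
      rw [hall (f 1 ∈ ·), hall (f 1 ∉ ·)]
      have hI : ∀ c : Finset α → Prop,
          subsetSum (natGround f 1 t) (fun S => (FenceDown f t ε S ∧ c S) ∧ f t ∈ S) w =
          subsetSum (natGround f 1 t) (fun S => (FenceDown f t ε S ∧ f t ∈ S) ∧ c S) w :=
        fun c => subsetSum_congr fun S _ => and_right_comm
      rw [hI (f 1 ∈ ·), hI (f 1 ∉ ·)]
      refine Eq.trans ?_ ((congrArg (fun x => (x +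
        subsetSum (natGround f 1 t) (fun T => (FenceDown f t ε T ∧ f t ∈ T) ∧ f 1 ∈ T) w *
        subsetSum (natGround f 1 t) (fun T => (FenceDown f t ε T ∧ f t ∈ T) ∧ f 1 ∉ T) w) *
          w (f (t + 1))) ih).trans ?_) <;> ring

end Fence

/-- Multiplicativity of the `2 × 2` determinant, without subtraction. -/
theorem det_mul_add {K : Type*} [CommSemiring K] {x₀ x₁ y₀ y₁ a₀ a₁ b₀ b₁ v v' : K}
    (h : x₀ * y₁ = x₁ * y₀ + v) (h' : a₀ * b₁ = a₁ * b₀ + v') :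
    (x₀ * a₀ + x₁ * a₁) * (y₀ * b₀ + y₁ * b₁) =
      (x₀ * b₀ + x₁ * b₁) * (y₀ * a₀ + y₁ * a₁) + v * v' := by
  calc (x₀ * a₀ + x₁ * a₁) * (y₀ * b₀ + y₁ * b₁)
      = x₀ * y₀ * a₀ * b₀ + x₁ * y₁ * a₁ * b₁ + (x₀ * y₁) * (a₀ * b₁)
          + x₁ * y₀ * (a₁ * b₀) := by ring
    _ = x₀ * y₀ * a₀ * b₀ + x₁ * y₁ * a₁ * b₁ + (x₁ * y₀ + v) * (a₁ * b₀)
          + x₁ * y₀ * (a₁ * b₀ + v') + v * v' := by rw [h, h']; ring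
    _ = _ := by rw [← h, ← h']; ring

section Winding

variable {K : Type*} [CommSemiring K]

/-- One full turn of the winding chain meets every spoke weight exactly once. -/
theorem prod_winding_period (s : ℕ → K) {k m : ℕ} (hk : 1 ≤ k) :
    ∏ i ∈ Finset.range m, s ((k + (i + 1) - 2) % m + 1) = ∏ i ∈ Finset.range m, s (i + 1) := by
  symm
  rw [← Nat.image_Ico_mod (k - 1) m, Finset.prod_image, Finset.prod_Ico_eq_prod_range,
    Nat.image_Ico_mod]
  · rw [Nat.add_sub_cancel_left]
    refine Finset.prod_congr rfl fun i _ => ?_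
    rw [show k + (i + 1) - 2 = k - 1 + i by lia]
  · intro x hx y hy e
    exact Nat.mod_injOn_Ico (k - 1) m hx hy e

theorem winding_sum_aux {p q : ℕ → K} {L m : ℕ} {c : K} (n : ℕ) {f : ℕ → K}
    (hf : ∀ j, f (m + j) = c * f j) (hL : ∀ j < m, f (n + j) = p L * q j) :
    ∑ j ∈ Finset.range n, f j + (∑ j ∈ Finset.range m, q j) * p L =
      c * ∑ j ∈ Finset.range n, f j + ∑ j ∈ Finset.range m, f j := by
  have h₁ : (∑ j ∈ Finset.range m, q j) * p L = ∑ j ∈ Finset.range m, f (n + j) := by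
    rw [Finset.sum_mul]
    refine Finset.sum_congr rfl fun j hj => ?_
    rw [hL j (Finset.mem_range.1 hj), mul_comm]
  have h₂ : c * ∑ j ∈ Finset.range n, f j = ∑ j ∈ Finset.range n, f (m + j) := by
    rw [Finset.mul_sum]
    exact Finset.sum_congr rfl fun j _ => (hf j).symm
  rw [h₁, h₂, ← Finset.sum_range_add, add_comm (∑ j ∈ Finset.range n, f (m + j)),
    ← Finset.sum_range_add, add_comm]

/-- The determinant of the spoke block against the winding block, in terms of the partial
products of the spoke weights. -/
theorem winding_det (p q : ℕ → K) (L m : ℕ) (x₁ x₀ : K)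
    (hq : q 0 = 1) (hm : ∀ j, p (m + 1 + j) = q (m + 1) * p j)
    (hL : ∀ j < m + 1, p (L + 1 + j) = p (L + 1) * q j) :
    (∑ j ∈ Finset.range (m + 1), q j) *
        ((∑ j ∈ Finset.range (L + 1), p (j + 1)) * x₁ +
          (∑ j ∈ Finset.range (L + 1 + 1), p j) * x₀) =
      (∑ j ∈ Finset.range (m + 1), q (j + 1)) *
          ((∑ j ∈ Finset.range L, p (j + 1)) * x₁ + (∑ j ∈ Finset.range (L + 1), p j) * x₀) +
        ((∑ j ∈ Finset.range (m + 1), p (j + 1)) * x₁ +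
          (∑ j ∈ Finset.range (m + 1), p j) * x₀) := by
  have e₀ := winding_sum_aux (p := p) (q := q) (L := L + 1) (L + 1) hm hL
  have e₁ := winding_sum_aux (p := p) (q := q) (L := L + 1) (m := m + 1) (c := q (m + 1))
    (f := fun j => p (j + 1)) L (fun j => hm (j + 1))
    (fun j hj => by rw [← hL j hj]; congr 1; lia)
  rw [Finset.sum_range_succ (fun j => p (j + 1)) L, Finset.sum_range_succ p (L + 1)]
  have hA₀ : ∑ j ∈ Finset.range (m + 1), q j = 1 + ∑ j ∈ Finset.range m, q (j + 1) := by
    rw [Finset.sum_range_succ', hq, add_comm]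
  have hA₁ := Finset.sum_range_succ (fun j => q (j + 1)) m
  generalize ∑ j ∈ Finset.range (m + 1), q j = a₀ at *
  generalize ∑ j ∈ Finset.range (m + 1), q (j + 1) = a₁ at *
  generalize ∑ j ∈ Finset.range m, q (j + 1) = a at *
  generalize ∑ j ∈ Finset.range (L + 1), p j = d₀ at *
  generalize ∑ j ∈ Finset.range L, p (j + 1) = d₁ at *
  calc a₀ * ((d₁ + p (L + 1)) * x₁ + (d₀ + p (L + 1)) * x₀)
      = a₀ * (d₁ * x₁ + d₀ * x₀) + (a₀ * p (L + 1)) * (x₁ + x₀) := by ring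
    _ = a * (d₁ * x₁ + d₀ * x₀) + ((d₁ + a₀ * p (L + 1)) * x₁ + (d₀ + a₀ * p (L + 1)) * x₀) := by
        nth_rewrite 1 [hA₀]; ring
    _ = _ := by rw [e₀, e₁, hA₁]; ring

end Winding

section Configurations

/-- The down-sets of a chain `f 1 ≺ ⋯ ≺ f n` with boundary conditions `a` and `b`. -/
def chainSum {α K : Type*} [CommSemiring K] (f : ℕ → α) (n : ℕ) (w : α → K) (a b : Prop) : K :=
  subsetSum (natGround f 1 n) (fun S => ChainDown f n S ∧ (a → f 1 ∈ S) ∧ (f n ∈ S → b)) w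

/-- The sum over the down-sets of the fence on `f 1, …, f t`, with boundary values `A` at `f 1`
and `E` at `f t`. -/
def overlapSum {α K : Type*} [CommSemiring K] (f : ℕ → α) (t : ℕ) (ε : ℕ → Bool) (w : α → K)
    (A E : Prop → K) : K :=
  (A False * subsetSum (natGround f 1 t) (fun T => (FenceDown f t ε T ∧ f t ∉ T) ∧ f 1 ∉ T) w +
    A True * subsetSum (natGround f 1 t) (fun T => (FenceDown f t ε T ∧ f t ∉ T) ∧ f 1 ∈ T) w) *
      E False +
  (A False * subsetSum (natGround f 1 t) (fun T => (FenceDown f t ε T ∧ f t ∈ T) ∧ f 1 ∉ T) w +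
    A True * subsetSum (natGround f 1 t) (fun T => (FenceDown f t ε T ∧ f t ∈ T) ∧ f 1 ∈ T) w) *
      E True

/-- The down-sets of a poset, containing `f x` if `b` holds. -/
def upTailSum {P α K : Type*} [Fintype P] [PartialOrder P] [CommSemiring K] (f : P → α)
    (w : α → K) (x : P) (b : Prop) : K :=
  subsetSum (posetGround f) (fun V => PosetDown f V ∧ (b → f x ∈ V)) w

/-- The down-sets of a poset, containing `f x` only if `b` holds. -/
def downTailSum {P α K : Type*} [Fintype P] [PartialOrder P] [CommSemiring K] (f : P → α)
    (w : α → K) (x : P) (b : Prop) : K :=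
  subsetSum (posetGround f) (fun V => PosetDown f V ∧ (f x ∈ V → b)) w

theorem overlapSum_mul {α K : Type*} [CommSemiring K] {f : ℕ → α} (hf : Function.Injective f)
    {t : ℕ} (ht : 1 ≤ t) (ε : ℕ → Bool) (w : α → K) {A D E E' : Prop → K} {v v' : K}
    (h : A False * D True = A True * D False + v)
    (h' : E False * E' True = E True * E' False + v') :
    overlapSum f t ε w A E * overlapSum f t ε w D E' =
      overlapSum f t ε w A E' * overlapSum f t ε w D E +
        (∏ i ∈ Finset.Icc 1 t, w (f i)) * (v * v') := by
  unfold overlapSum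
  rw [det_mul_add (det_mul_add h (fence_det hf ε t ht)) h']
  ring

variable {K M B₁ B₂ : Type*} [CommSemiring K]

/-- The configuration of a tail `M` and a winding chain, the end of the chain being forbidden
unless `a` holds. -/
def windingSum [Fintype M] [PartialOrder M] (L : ℕ) (μ : M)
    (w : M ⊕ (B₁ ⊕ (B₂ ⊕ (ℕ ⊕ (ℕ ⊕ ℕ)))) → K) (a : Prop) : K :=
  subsetSum (posetGround (eM M B₁ B₂) ∪ natGround (eC M B₁ B₂) 1 L)
    (fun S => PosetDown (eM M B₁ B₂) S ∧ ChainDown (eC M B₁ B₂) L S ∧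
      (eM M B₁ B₂ μ ∈ S → eC M B₁ B₂ 1 ∈ S) ∧ (eC M B₁ B₂ L ∈ S → a)) w

theorem tail_det [Fintype B₁] [PartialOrder B₁] [Fintype B₂] [PartialOrder B₂]
    (b₁ : B₁) (b₂ : B₂) (w : M ⊕ (B₁ ⊕ (B₂ ⊕ (ℕ ⊕ (ℕ ⊕ ℕ)))) → K) :
    upTailSum (eB1 M B₁ B₂) w b₁ False * downTailSum (eB2 M B₁ B₂) w b₂ True =
      upTailSum (eB1 M B₁ B₂) w b₁ True * downTailSum (eB2 M B₁ B₂) w b₂ False +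
      idealSum (posetGround (eB1 M B₁ B₂) ∪ posetGround (eB2 M B₁ B₂))
        (posetRel (eB1 M B₁ B₂) ⊔ posetRel (eB2 M B₁ B₂) ⊔
          covRel (eB2 M B₁ B₂ b₂) (eB1 M B₁ B₂ b₁)) w := by
  rw [idealSum_eq_subsetSum, subsetSum_union (w := w) (G := posetGround (eB1 M B₁ B₂))
      (H := posetGround (eB2 M B₁ B₂)) (P := IsDown _ _) (q := eB2 M B₁ B₂ b₂)
      (PG := fun a V => PosetDown (eB1 M B₁ B₂) V ∧ (eB1 M B₁ B₂ b₁ ∈ V → a))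
      (PH := PosetDown (eB2 M B₁ B₂))]
  · unfold upTailSum downTailSum
    rw [subsetSum_eq_add _ (fun V => PosetDown (eB1 M B₁ B₂) V ∧ (False → _))
        (eB1 M B₁ B₂ b₁ ∈ ·),
      subsetSum_eq_add _ (fun V => PosetDown (eB2 M B₁ B₂) V ∧ (_ → True))
        (eB2 M B₁ B₂ b₂ ∈ ·),
      subsetSum_eq_add _ (fun V => PosetDown (eB1 M B₁ B₂) V ∧ (_ → True))
        (eB1 M B₁ B₂ b₁ ∈ ·)]
    simp only [false_imp_iff, and_true, imp_true_iff, true_imp_iff, imp_false]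
    ring
  · simp [posetGround, Finset.disjoint_left, eB1, eB2]
  · simp [posetGround]
  · intro S hS T hT
    have hS' : ∀ y, eB2 M B₁ B₂ y ∉ S := fun y hy => by
      simpa [posetGround, eB1, eB2] using hS hy
    have hT' : ∀ y, eB1 M B₁ B₂ y ∉ T := fun y hy => by
      simpa [posetGround, eB1, eB2] using hT hy
    rw [isDown_sup, isDown_sup, isDown_posetRel Finset.subset_union_left,
      isDown_posetRel Finset.subset_union_right, isDown_covRel (by simp [posetGround])]
    simp only [PosetDown, Finset.mem_union, hS', hT', or_false, false_or]
    tauto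

theorem idealSum_spokes_B₁ [Fintype B₁] [PartialOrder B₁] {t m : ℕ} (ht : 1 ≤ t)
    (hm : 1 ≤ m) (ε : ℕ → Bool) (b₁ : B₁) (w : M ⊕ (B₁ ⊕ (B₂ ⊕ (ℕ ⊕ (ℕ ⊕ ℕ)))) → K) :
    idealSum
        (natGround (eS M B₁ B₂) 1 m ∪ natGround (eR M B₁ B₂) 1 t ∪
          posetGround (eB1 M B₁ B₂))
        (chainRel (eS M B₁ B₂) 1 m ⊔ fenceRel (eR M B₁ B₂) t ε ⊔
          posetRel (eB1 M B₁ B₂) ⊔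
          covRel (eS M B₁ B₂ 1) (eR M B₁ B₂ 1) ⊔
          covRel (eR M B₁ B₂ 1) (eS M B₁ B₂ m) ⊔
          covRel (eB1 M B₁ B₂ b₁) (eR M B₁ B₂ t)) w =
      overlapSum (eR M B₁ B₂) t ε w (fun a => chainSum (eS M B₁ B₂) m w a a)
        (upTailSum (eB1 M B₁ B₂) w b₁) := by
  rw [idealSum_eq_subsetSum]
  unfold overlapSum upTailSum chainSum
  refine subsetSum_union_three (w := w) (p := eR M B₁ B₂ 1) (q := eR M B₁ B₂ t)
    (PG := fun a S => ChainDown (eS M B₁ B₂) m S ∧ (a → eS M B₁ B₂ 1 ∈ S) ∧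
      (eS M B₁ B₂ m ∈ S → a))
    (PR := FenceDown (eR M B₁ B₂) t ε)
    (PH := fun b V => PosetDown (eB1 M B₁ B₂) V ∧ (b → eB1 M B₁ B₂ b₁ ∈ V))
    ?_ ?_ ?_ (mem_natGround le_rfl ht) (mem_natGround ht le_rfl) ?_
  · simp [natGround, Finset.disjoint_left, eS, eR]
  · simp [natGround, posetGround, Finset.disjoint_left, eS, eB1]
  · simp [natGround, posetGround, Finset.disjoint_left, eR, eB1]
  · intro S hS T hT V hV
    set X := natGround (eS M B₁ B₂) 1 m ∪ natGround (eR M B₁ B₂) 1 t ∪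
        posetGround (eB1 M B₁ B₂)
    have hSR : ∀ y, eR M B₁ B₂ y ∉ S := fun y h => by
      simpa [natGround, posetGround, eS, eR, eB1] using hS h
    have hSB1 : ∀ y, eB1 M B₁ B₂ y ∉ S := fun y h => by
      simpa [natGround, posetGround, eS, eR, eB1] using hS h
    have hTS : ∀ y, eS M B₁ B₂ y ∉ T := fun y h => by
      simpa [natGround, posetGround, eS, eR, eB1] using hT h
    have hTB1 : ∀ y, eB1 M B₁ B₂ y ∉ T := fun y h => by
      simpa [natGround, posetGround, eS, eR, eB1] using hT h
    have hVS : ∀ y, eS M B₁ B₂ y ∉ V := fun y h => by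
      simpa [natGround, posetGround, eS, eR, eB1] using hV h
    have hVR : ∀ y, eR M B₁ B₂ y ∉ V := fun y h => by
      simpa [natGround, posetGround, eS, eR, eB1] using hV h
    have hG : natGround (eS M B₁ B₂) 1 m ⊆ X := by grind
    have hR : natGround (eR M B₁ B₂) 1 t ⊆ X := by grind
    have hH : posetGround (eB1 M B₁ B₂) ⊆ X := by grind
    simp only [isDown_sup]
    rw [isDown_chainRel hG, isDown_fenceRel hR, isDown_posetRel hH,
      isDown_covRel (hG (mem_natGround le_rfl hm)), isDown_covRel (hR (mem_natGround le_rfl ht)),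
      isDown_covRel (hH (mem_posetGround _ b₁))]
    simp only [ChainDown, FenceDown, PosetDown, Finset.mem_union, hSR, hSB1, hTS, hTB1, hVS, hVR,
      or_false, false_or]
    tauto

theorem idealSum_spokes_B₂ [Fintype B₂] [PartialOrder B₂] {t m : ℕ} (ht : 1 ≤ t)
    (hm : 1 ≤ m) (ε : ℕ → Bool) (b₂ : B₂) (w : M ⊕ (B₁ ⊕ (B₂ ⊕ (ℕ ⊕ (ℕ ⊕ ℕ)))) → K) :
    idealSum
        (natGround (eS M B₁ B₂) 1 m ∪ natGround (eR M B₁ B₂) 1 t ∪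
          posetGround (eB2 M B₁ B₂))
        (chainRel (eS M B₁ B₂) 1 m ⊔ fenceRel (eR M B₁ B₂) t ε ⊔
          posetRel (eB2 M B₁ B₂) ⊔
          covRel (eS M B₁ B₂ 1) (eR M B₁ B₂ 1) ⊔
          covRel (eR M B₁ B₂ 1) (eS M B₁ B₂ m) ⊔
          covRel (eR M B₁ B₂ t) (eB2 M B₁ B₂ b₂)) w =
      overlapSum (eR M B₁ B₂) t ε w (fun a => chainSum (eS M B₁ B₂) m w a a)
        (downTailSum (eB2 M B₁ B₂) w b₂) := by
  rw [idealSum_eq_subsetSum]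
  unfold overlapSum downTailSum chainSum
  refine subsetSum_union_three (w := w) (p := eR M B₁ B₂ 1) (q := eR M B₁ B₂ t)
    (PG := fun a S => ChainDown (eS M B₁ B₂) m S ∧ (a → eS M B₁ B₂ 1 ∈ S) ∧
      (eS M B₁ B₂ m ∈ S → a))
    (PR := FenceDown (eR M B₁ B₂) t ε)
    (PH := fun b V => PosetDown (eB2 M B₁ B₂) V ∧ (eB2 M B₁ B₂ b₂ ∈ V → b))
    ?_ ?_ ?_ (mem_natGround le_rfl ht) (mem_natGround ht le_rfl) ?_
  · simp [natGround, Finset.disjoint_left, eS, eR]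
  · simp [natGround, posetGround, Finset.disjoint_left, eS, eB2]
  · simp [natGround, posetGround, Finset.disjoint_left, eR, eB2]
  · intro S hS T hT V hV
    set X := natGround (eS M B₁ B₂) 1 m ∪ natGround (eR M B₁ B₂) 1 t ∪
        posetGround (eB2 M B₁ B₂)
    have hSR : ∀ y, eR M B₁ B₂ y ∉ S := fun y h => by
      simpa [natGround, posetGround, eS, eR, eB2] using hS h
    have hSB2 : ∀ y, eB2 M B₁ B₂ y ∉ S := fun y h => by
      simpa [natGround, posetGround, eS, eR, eB2] using hS h
    have hTS : ∀ y, eS M B₁ B₂ y ∉ T := fun y h => by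
      simpa [natGround, posetGround, eS, eR, eB2] using hT h
    have hTB2 : ∀ y, eB2 M B₁ B₂ y ∉ T := fun y h => by
      simpa [natGround, posetGround, eS, eR, eB2] using hT h
    have hVS : ∀ y, eS M B₁ B₂ y ∉ V := fun y h => by
      simpa [natGround, posetGround, eS, eR, eB2] using hV h
    have hVR : ∀ y, eR M B₁ B₂ y ∉ V := fun y h => by
      simpa [natGround, posetGround, eS, eR, eB2] using hV h
    have hG : natGround (eS M B₁ B₂) 1 m ⊆ X := by grind
    have hR : natGround (eR M B₁ B₂) 1 t ⊆ X := by grind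
    have hH : posetGround (eB2 M B₁ B₂) ⊆ X := by grind
    simp only [isDown_sup]
    rw [isDown_chainRel hG, isDown_fenceRel hR, isDown_posetRel hH,
      isDown_covRel (hG (mem_natGround le_rfl hm)), isDown_covRel (hR (mem_natGround le_rfl ht)),
      isDown_covRel (hR (mem_natGround ht le_rfl))]
    simp only [ChainDown, FenceDown, PosetDown, Finset.mem_union, hSR, hSB2, hTS, hTB2, hVS, hVR,
      or_false, false_or]
    tauto

theorem idealSum_winding_B₂ [Fintype M] [PartialOrder M] [Fintype B₂] [PartialOrder B₂]
    {t m : ℕ} (ht : 1 ≤ t) (hm : 1 ≤ m) (ε : ℕ → Bool) (μ : M) (b₂ : B₂) (w : M ⊕ (B₁ ⊕ (B₂ ⊕ (ℕ ⊕ (ℕ ⊕ ℕ)))) → K) :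
    idealSum
        (posetGround (eM M B₁ B₂) ∪ natGround (eC M B₁ B₂) 1 m ∪ natGround (eR M B₁ B₂) 1 t ∪
          posetGround (eB2 M B₁ B₂))
        (posetRel (eM M B₁ B₂) ⊔ posetRel (eB2 M B₁ B₂) ⊔
          chainRel (eC M B₁ B₂) 1 m ⊔
          fenceRel (eR M B₁ B₂) t ε ⊔
          covRel (eC M B₁ B₂ 1) (eM M B₁ B₂ μ) ⊔
          covRel (eR M B₁ B₂ 1) (eC M B₁ B₂ m) ⊔
          covRel (eR M B₁ B₂ t) (eB2 M B₁ B₂ b₂)) w =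
      overlapSum (eR M B₁ B₂) t ε w (windingSum m μ w)
        (downTailSum (eB2 M B₁ B₂) w b₂) := by
  rw [idealSum_eq_subsetSum]
  unfold overlapSum downTailSum windingSum
  refine subsetSum_union_three (w := w) (p := eR M B₁ B₂ 1) (q := eR M B₁ B₂ t)
    (PG := fun a S => PosetDown (eM M B₁ B₂) S ∧ ChainDown (eC M B₁ B₂) m S ∧
      (eM M B₁ B₂ μ ∈ S → eC M B₁ B₂ 1 ∈ S) ∧ (eC M B₁ B₂ m ∈ S → a))
    (PR := FenceDown (eR M B₁ B₂) t ε)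
    (PH := fun b V => PosetDown (eB2 M B₁ B₂) V ∧ (eB2 M B₁ B₂ b₂ ∈ V → b))
    ?_ ?_ ?_ (mem_natGround le_rfl ht) (mem_natGround ht le_rfl) ?_
  · simp [natGround, posetGround, Finset.disjoint_left, eM, eC, eR]
  · simp [natGround, posetGround, Finset.disjoint_left, eM, eC, eB2]
  · simp [natGround, posetGround, Finset.disjoint_left, eR, eB2]
  · intro S hS T hT V hV
    set X := posetGround (eM M B₁ B₂) ∪ natGround (eC M B₁ B₂) 1 m ∪ natGround (eR M B₁ B₂) 1 t ∪
        posetGround (eB2 M B₁ B₂)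
    have hSR : ∀ y, eR M B₁ B₂ y ∉ S := fun y h => by
      simpa [natGround, posetGround, eM, eC, eR, eB2] using hS h
    have hSB2 : ∀ y, eB2 M B₁ B₂ y ∉ S := fun y h => by
      simpa [natGround, posetGround, eM, eC, eR, eB2] using hS h
    have hTM : ∀ y, eM M B₁ B₂ y ∉ T := fun y h => by
      simpa [natGround, posetGround, eM, eC, eR, eB2] using hT h
    have hTC : ∀ y, eC M B₁ B₂ y ∉ T := fun y h => by
      simpa [natGround, posetGround, eM, eC, eR, eB2] using hT h
    have hTB2 : ∀ y, eB2 M B₁ B₂ y ∉ T := fun y h => by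
      simpa [natGround, posetGround, eM, eC, eR, eB2] using hT h
    have hVM : ∀ y, eM M B₁ B₂ y ∉ V := fun y h => by
      simpa [natGround, posetGround, eM, eC, eR, eB2] using hV h
    have hVC : ∀ y, eC M B₁ B₂ y ∉ V := fun y h => by
      simpa [natGround, posetGround, eM, eC, eR, eB2] using hV h
    have hVR : ∀ y, eR M B₁ B₂ y ∉ V := fun y h => by
      simpa [natGround, posetGround, eM, eC, eR, eB2] using hV h
    have hM : posetGround (eM M B₁ B₂) ⊆ X := by grind
    have hG : natGround (eC M B₁ B₂) 1 m ⊆ X := by grind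
    have hR : natGround (eR M B₁ B₂) 1 t ⊆ X := by grind
    have hH : posetGround (eB2 M B₁ B₂) ⊆ X := by grind
    simp only [isDown_sup]
    rw [isDown_posetRel hM, isDown_posetRel hH, isDown_chainRel hG, isDown_fenceRel hR,
      isDown_covRel (hG (mem_natGround le_rfl hm)), isDown_covRel (hR (mem_natGround le_rfl ht)),
      isDown_covRel (hR (mem_natGround ht le_rfl))]
    simp only [ChainDown, FenceDown, PosetDown, Finset.mem_union, hSR, hSB2, hTM, hTC, hTB2, hVM, hVC,
      hVR, or_false, false_or]
    tauto

theorem idealSum_winding_B₁ [Fintype M] [PartialOrder M] [Fintype B₁] [PartialOrder B₁]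
    {t m : ℕ} (ht : 1 ≤ t) (hm : 1 ≤ m) (ε : ℕ → Bool) (μ : M) (b₁ : B₁) (w : M ⊕ (B₁ ⊕ (B₂ ⊕ (ℕ ⊕ (ℕ ⊕ ℕ)))) → K) :
    idealSum
        (posetGround (eM M B₁ B₂) ∪ natGround (eC M B₁ B₂) 1 m ∪ natGround (eR M B₁ B₂) 1 t ∪
          posetGround (eB1 M B₁ B₂))
        (posetRel (eM M B₁ B₂) ⊔ posetRel (eB1 M B₁ B₂) ⊔
          chainRel (eC M B₁ B₂) 1 m ⊔
          fenceRel (eR M B₁ B₂) t ε ⊔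
          covRel (eC M B₁ B₂ 1) (eM M B₁ B₂ μ) ⊔
          covRel (eR M B₁ B₂ 1) (eC M B₁ B₂ m) ⊔
          covRel (eB1 M B₁ B₂ b₁) (eR M B₁ B₂ t)) w =
      overlapSum (eR M B₁ B₂) t ε w (windingSum m μ w)
        (upTailSum (eB1 M B₁ B₂) w b₁) := by
  rw [idealSum_eq_subsetSum]
  unfold overlapSum upTailSum windingSum
  refine subsetSum_union_three (w := w) (p := eR M B₁ B₂ 1) (q := eR M B₁ B₂ t)
    (PG := fun a S => PosetDown (eM M B₁ B₂) S ∧ ChainDown (eC M B₁ B₂) m S ∧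
      (eM M B₁ B₂ μ ∈ S → eC M B₁ B₂ 1 ∈ S) ∧ (eC M B₁ B₂ m ∈ S → a))
    (PR := FenceDown (eR M B₁ B₂) t ε)
    (PH := fun b V => PosetDown (eB1 M B₁ B₂) V ∧ (b → eB1 M B₁ B₂ b₁ ∈ V))
    ?_ ?_ ?_ (mem_natGround le_rfl ht) (mem_natGround ht le_rfl) ?_
  · simp [natGround, posetGround, Finset.disjoint_left, eM, eC, eR]
  · simp [natGround, posetGround, Finset.disjoint_left, eM, eC, eB1]
  · simp [natGround, posetGround, Finset.disjoint_left, eR, eB1]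
  · intro S hS T hT V hV
    set X := posetGround (eM M B₁ B₂) ∪ natGround (eC M B₁ B₂) 1 m ∪ natGround (eR M B₁ B₂) 1 t ∪
        posetGround (eB1 M B₁ B₂)
    have hSR : ∀ y, eR M B₁ B₂ y ∉ S := fun y h => by
      simpa [natGround, posetGround, eM, eC, eR, eB1] using hS h
    have hSB1 : ∀ y, eB1 M B₁ B₂ y ∉ S := fun y h => by
      simpa [natGround, posetGround, eM, eC, eR, eB1] using hS h
    have hTM : ∀ y, eM M B₁ B₂ y ∉ T := fun y h => by
      simpa [natGround, posetGround, eM, eC, eR, eB1] using hT h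
    have hTC : ∀ y, eC M B₁ B₂ y ∉ T := fun y h => by
      simpa [natGround, posetGround, eM, eC, eR, eB1] using hT h
    have hTB1 : ∀ y, eB1 M B₁ B₂ y ∉ T := fun y h => by
      simpa [natGround, posetGround, eM, eC, eR, eB1] using hT h
    have hVM : ∀ y, eM M B₁ B₂ y ∉ V := fun y h => by
      simpa [natGround, posetGround, eM, eC, eR, eB1] using hV h
    have hVC : ∀ y, eC M B₁ B₂ y ∉ V := fun y h => by
      simpa [natGround, posetGround, eM, eC, eR, eB1] using hV h
    have hVR : ∀ y, eR M B₁ B₂ y ∉ V := fun y h => by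
      simpa [natGround, posetGround, eM, eC, eR, eB1] using hV h
    have hM : posetGround (eM M B₁ B₂) ⊆ X := by grind
    have hG : natGround (eC M B₁ B₂) 1 m ⊆ X := by grind
    have hR : natGround (eR M B₁ B₂) 1 t ⊆ X := by grind
    have hH : posetGround (eB1 M B₁ B₂) ⊆ X := by grind
    simp only [isDown_sup]
    rw [isDown_posetRel hM, isDown_posetRel hH, isDown_chainRel hG, isDown_fenceRel hR,
      isDown_covRel (hG (mem_natGround le_rfl hm)), isDown_covRel (hR (mem_natGround le_rfl ht)),
      isDown_covRel (hH (mem_posetGround _ b₁))]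
    simp only [ChainDown, FenceDown, PosetDown, Finset.mem_union, hSR, hSB1, hTM, hTC, hTB1, hVM, hVC,
      hVR, or_false, false_or]
    tauto

theorem windingSum_eq [Fintype M] [PartialOrder M] {L : ℕ} (μ : M) (w : M ⊕ (B₁ ⊕ (B₂ ⊕ (ℕ ⊕ (ℕ ⊕ ℕ)))) → K) (a : Prop) :
    windingSum L μ w a =
      chainSum (eC M B₁ B₂) L w True a *
          subsetSum (posetGround (eM M B₁ B₂))
            (fun V => PosetDown (eM M B₁ B₂) V ∧ eM M B₁ B₂ μ ∈ V) w +
        chainSum (eC M B₁ B₂) L w False a *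
          subsetSum (posetGround (eM M B₁ B₂))
            (fun V => PosetDown (eM M B₁ B₂) V ∧ eM M B₁ B₂ μ ∉ V) w := by
  unfold windingSum chainSum
  rw [Finset.union_comm]
  refine subsetSum_union (w := w) (q := eM M B₁ B₂ μ)
    (PG := fun b S => ChainDown (eC M B₁ B₂) L S ∧ (b → eC M B₁ B₂ 1 ∈ S) ∧
      (eC M B₁ B₂ L ∈ S → a))
    (PH := PosetDown (eM M B₁ B₂)) ?_ ?_ ?_
  · simp [natGround, posetGround, Finset.disjoint_left, eM, eC]
  · simp [posetGround]
  · intro S hS T hT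
    have hS' : ∀ y, eM M B₁ B₂ y ∉ S := fun y hy => by
      simpa [natGround, eM, eC] using hS hy
    have hT' : ∀ y, eC M B₁ B₂ y ∉ T := fun y hy => by
      simpa [posetGround, eM, eC] using hT hy
    simp only [ChainDown, PosetDown, Finset.mem_union, hS', hT', or_false, false_or]
    tauto

theorem natGround_winding {α : Type*} (f : ℕ → α) {k m : ℕ} (hk : 1 ≤ k) :
    natGround (fun j => f ((k + j - 2) % m + 1)) 1 m = natGround f 1 m := by
  have h : natGround f 1 m = (Finset.range m).image (fun i => f (i + 1)) := by
    unfold natGround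
    ext x
    simp only [Finset.mem_image, Finset.mem_Icc, Finset.mem_range]
    constructor
    · rintro ⟨i, hi, rfl⟩
      exact ⟨i - 1, by lia, by rw [Nat.sub_add_cancel hi.1]⟩
    · rintro ⟨i, hi, rfl⟩
      exact ⟨i + 1, by lia, rfl⟩
  rw [h, ← Nat.image_Ico_mod (k - 1) m]
  unfold natGround
  ext x
  simp only [Finset.mem_image, Finset.mem_Icc, Finset.mem_Ico, exists_exists_and_eq_and]
  constructor
  · rintro ⟨i, hi, rfl⟩
    exact ⟨k + i - 2, by lia, rfl⟩
  · rintro ⟨i, hi, rfl⟩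
    exact ⟨i + 2 - k, by lia, by rw [show k + (i + 2 - k) - 2 = i by lia]⟩

theorem injOn_winding {k m : ℕ} (hk : 1 ≤ k) :
    Set.InjOn (fun j => (k + j - 2) % m + 1) (Set.Icc 1 m) := by
  intro i hi j hj e
  simp only [Set.mem_Icc, Nat.add_right_cancel_iff] at hi hj e
  have := Nat.mod_injOn_Ico (k - 1) m
    (by simp only [Finset.coe_Ico, Set.mem_Ico]; lia : k + i - 2 ∈ _)
    (by simp only [Finset.coe_Ico, Set.mem_Ico]; lia : k + j - 2 ∈ _) e
  lia

theorem idealSum_M_union_spokes [Fintype M] [PartialOrder M] {k m : ℕ} (hm : 1 ≤ m)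
    (hk : 1 ≤ k) (hkm : k ≤ m) (μ : M) (w : M ⊕ (B₁ ⊕ (B₂ ⊕ (ℕ ⊕ (ℕ ⊕ ℕ)))) → K) :
    idealSum (posetGround (eM M B₁ B₂) ∪ natGround (eS M B₁ B₂) 1 m)
        (posetRel (eM M B₁ B₂) ⊔
          chainRel (fun j => eS M B₁ B₂ ((k + j - 2) % m + 1)) 1 m ⊔
          covRel (eS M B₁ B₂ k) (eM M B₁ B₂ μ) ⊔
          covRel (eM M B₁ B₂ μ) (eS M B₁ B₂ ((k + m - 2) % m + 1))) w =
      chainSum (fun j => eS M B₁ B₂ ((k + j - 2) % m + 1)) m w True True *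
          subsetSum (posetGround (eM M B₁ B₂))
            (fun V => PosetDown (eM M B₁ B₂) V ∧ eM M B₁ B₂ μ ∈ V) w +
        chainSum (fun j => eS M B₁ B₂ ((k + j - 2) % m + 1)) m w False False *
          subsetSum (posetGround (eM M B₁ B₂))
            (fun V => PosetDown (eM M B₁ B₂) V ∧ eM M B₁ B₂ μ ∉ V) w := by
  have hfirst : eS M B₁ B₂ k = (fun j => eS M B₁ B₂ ((k + j - 2) % m + 1)) 1 := by
    have h : (k + 1 - 2) % m + 1 = k := by
      rw [Nat.mod_eq_of_lt (by lia)]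
      lia
    simp only [h]
  rw [idealSum_eq_subsetSum, Finset.union_comm, hfirst, ← natGround_winding (eS M B₁ B₂) hk]
  unfold chainSum
  refine subsetSum_union (w := w) (q := eM M B₁ B₂ μ)
    (PG := fun b S => ChainDown (fun j => eS M B₁ B₂ ((k + j - 2) % m + 1)) m S ∧
      (b → (fun j => eS M B₁ B₂ ((k + j - 2) % m + 1)) 1 ∈ S) ∧
      (eS M B₁ B₂ ((k + m - 2) % m + 1) ∈ S → b))
    (PH := PosetDown (eM M B₁ B₂)) ?_ ?_ ?_
  · simp [natGround, posetGround, Finset.disjoint_left, eM, eS]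
  · simp [posetGround]
  · intro S hS T hT
    have hS' : ∀ y, eM M B₁ B₂ y ∉ S := fun y hy => by
      simpa [natGround, eM, eS] using hS hy
    have hT' : ∀ y, eS M B₁ B₂ y ∉ T := fun y hy => by
      simpa [posetGround, eM, eS] using hT hy
    simp only [isDown_sup]
    rw [isDown_posetRel Finset.subset_union_right, isDown_chainRel Finset.subset_union_left,
      isDown_covRel (Finset.mem_union_left _ (mem_natGround le_rfl hm)),
      isDown_covRel (by simp [posetGround])]
    simp only [ChainDown, PosetDown, Finset.mem_union, hS', hT', or_false, false_or]
    tauto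

end Configurations

theorem skein_type0_crossing_notched_end
    (K : Type*) [CommSemiring K]
    (t : ℕ) (ht : 1 ≤ t) (ε : ℕ → Bool)
    (m W k : ℕ) (hm : 2 ≤ m) (hW : 1 ≤ W) (hk1 : 1 ≤ k) (hk2 : k ≤ m)
    (M B₁ B₂ : Type*)
    [Fintype M] [PartialOrder M] [Fintype B₁] [PartialOrder B₁]
    [Fintype B₂] [PartialOrder B₂]
    (μ : M) (b₁ : B₁) (b₂ : B₂)
    (u s : ℕ → K) (wM : M → K) (x₁ : B₁ → K) (x₂ : B₂ → K) :
    -- Z(P₁) · Z(P₂)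
    idealSum
        (natGround (eS M B₁ B₂) 1 m ∪ natGround (eR M B₁ B₂) 1 t ∪
          posetGround (eB1 M B₁ B₂))
        (chainRel (eS M B₁ B₂) 1 m ⊔ fenceRel (eR M B₁ B₂) t ε ⊔
          posetRel (eB1 M B₁ B₂) ⊔
          covRel (eS M B₁ B₂ 1) (eR M B₁ B₂ 1) ⊔
          covRel (eR M B₁ B₂ 1) (eS M B₁ B₂ m) ⊔
          covRel (eB1 M B₁ B₂ b₁) (eR M B₁ B₂ t))
        (Sum.elim wM (Sum.elim x₁ (Sum.elim x₂
          (Sum.elim u (Sum.elim s (fun j => s ((k + j - 2) % m + 1))))))) *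
      idealSum
        (posetGround (eM M B₁ B₂) ∪
          natGround (eC M B₁ B₂) 1 ((W - 1) * m + (m - k + 1)) ∪
          natGround (eR M B₁ B₂) 1 t ∪ posetGround (eB2 M B₁ B₂))
        (posetRel (eM M B₁ B₂) ⊔ posetRel (eB2 M B₁ B₂) ⊔
          chainRel (eC M B₁ B₂) 1 ((W - 1) * m + (m - k + 1)) ⊔
          fenceRel (eR M B₁ B₂) t ε ⊔
          covRel (eC M B₁ B₂ 1) (eM M B₁ B₂ μ) ⊔
          covRel (eR M B₁ B₂ 1) (eC M B₁ B₂ ((W - 1) * m + (m - k + 1))) ⊔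
          covRel (eR M B₁ B₂ t) (eB2 M B₁ B₂ b₂))
        (Sum.elim wM (Sum.elim x₁ (Sum.elim x₂
          (Sum.elim u (Sum.elim s (fun j => s ((k + j - 2) % m + 1)))))))
    -- = Z(P₃) · Z(P₄) + (∏ u) · Z(P₅) · Z(P₆)
    = idealSum
        (natGround (eS M B₁ B₂) 1 m ∪ natGround (eR M B₁ B₂) 1 t ∪
          posetGround (eB2 M B₁ B₂))
        (chainRel (eS M B₁ B₂) 1 m ⊔ fenceRel (eR M B₁ B₂) t ε ⊔
          posetRel (eB2 M B₁ B₂) ⊔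
          covRel (eS M B₁ B₂ 1) (eR M B₁ B₂ 1) ⊔
          covRel (eR M B₁ B₂ 1) (eS M B₁ B₂ m) ⊔
          covRel (eR M B₁ B₂ t) (eB2 M B₁ B₂ b₂))
        (Sum.elim wM (Sum.elim x₁ (Sum.elim x₂
          (Sum.elim u (Sum.elim s (fun j => s ((k + j - 2) % m + 1))))))) *
      idealSum
        (posetGround (eM M B₁ B₂) ∪
          natGround (eC M B₁ B₂) 1 ((W - 1) * m + (m - k + 1)) ∪
          natGround (eR M B₁ B₂) 1 t ∪ posetGround (eB1 M B₁ B₂))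
        (posetRel (eM M B₁ B₂) ⊔ posetRel (eB1 M B₁ B₂) ⊔
          chainRel (eC M B₁ B₂) 1 ((W - 1) * m + (m - k + 1)) ⊔
          fenceRel (eR M B₁ B₂) t ε ⊔
          covRel (eC M B₁ B₂ 1) (eM M B₁ B₂ μ) ⊔
          covRel (eR M B₁ B₂ 1) (eC M B₁ B₂ ((W - 1) * m + (m - k + 1))) ⊔
          covRel (eB1 M B₁ B₂ b₁) (eR M B₁ B₂ t))
        (Sum.elim wM (Sum.elim x₁ (Sum.elim x₂
          (Sum.elim u (Sum.elim s (fun j => s ((k + j - 2) % m + 1)))))))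
      + (∏ i ∈ Finset.Icc 1 t, u i) *
        (idealSum
            (posetGround (eM M B₁ B₂) ∪ natGround (eS M B₁ B₂) 1 m)
            (posetRel (eM M B₁ B₂) ⊔
              chainRel (fun j => eS M B₁ B₂ ((k + j - 2) % m + 1)) 1 m ⊔
              covRel (eS M B₁ B₂ k) (eM M B₁ B₂ μ) ⊔
              covRel (eM M B₁ B₂ μ) (eS M B₁ B₂ ((k + m - 2) % m + 1)))
            (Sum.elim wM (Sum.elim x₁ (Sum.elim x₂
              (Sum.elim u (Sum.elim s (fun j => s ((k + j - 2) % m + 1))))))) *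
          idealSum
            (posetGround (eB1 M B₁ B₂) ∪ posetGround (eB2 M B₁ B₂))
            (posetRel (eB1 M B₁ B₂) ⊔ posetRel (eB2 M B₁ B₂) ⊔
              covRel (eB2 M B₁ B₂ b₂) (eB1 M B₁ B₂ b₁))
            (Sum.elim wM (Sum.elim x₁ (Sum.elim x₂
              (Sum.elim u (Sum.elim s (fun j => s ((k + j - 2) % m + 1)))))))) := by
  obtain ⟨m, rfl⟩ : ∃ m', m = m' + 1 := ⟨m - 1, by lia⟩
  rw [← Nat.add_assoc ((W - 1) * (m + 1))]
  set L := (W - 1) * (m + 1) + (m + 1 - k) with hL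
  have hsum : k + L = W * (m + 1) := by
    obtain ⟨W, rfl⟩ : ∃ W', W = W' + 1 := ⟨W - 1, by lia⟩
    rw [hL, Nat.add_sub_cancel, Nat.add_one_mul]
    lia
  set w : M ⊕ (B₁ ⊕ (B₂ ⊕ (ℕ ⊕ (ℕ ⊕ ℕ)))) → K := Sum.elim wM (Sum.elim x₁ (Sum.elim x₂
    (Sum.elim u (Sum.elim s (fun j => s ((k + j - 2) % (m + 1) + 1)))))) with hw
  rw [idealSum_spokes_B₁ ht (by lia), idealSum_winding_B₂ ht (by lia),
    idealSum_spokes_B₂ ht (by lia), idealSum_winding_B₁ ht (by lia),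
    idealSum_M_union_spokes (by lia) hk1 hk2]
  have hinj : Function.Injective (eR M B₁ B₂) := fun i j h => by simpa [eR] using h
  refine overlapSum_mul hinj ht ε w ?_ (tail_det b₁ b₂ w)
  have hS : Set.InjOn (eS M B₁ B₂) (Set.Icc 1 (m + 1)) := fun i _ j _ h => by simpa [eS] using h
  have hC : Set.InjOn (eC M B₁ B₂) (Set.Icc 1 (L + 1)) := fun i _ j _ h => by simpa [eC] using h
  have hZ : Set.InjOn (fun j => eS M B₁ B₂ ((k + j - 2) % (m + 1) + 1)) (Set.Icc 1 (m + 1)) :=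
    fun i hi j hj h => injOn_winding hk1 hi hj (by simpa [eS] using h)
  simp only [windingSum_eq]
  unfold chainSum
  simp only [subsetSum_chain hS (Nat.le_add_left _ _), subsetSum_chain hC (Nat.le_add_left _ _),
    subsetSum_chain hZ (Nat.le_add_left _ _), sum_filter_false_false, sum_filter_false_true,
    sum_filter_true_true, sum_filter_true_false]
  refine winding_det (fun j => ∏ i ∈ Finset.range j, s ((k + (i + 1) - 2) % (m + 1) + 1))
    (fun j => ∏ i ∈ Finset.range j, s (i + 1)) L m _ _ rfl (fun j => ?_) (fun j hj => ?_)
  · simp only [Finset.prod_range_add, ← prod_winding_period s (m := m + 1) hk1]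
    congr 1
    refine Finset.prod_congr rfl fun i _ => ?_
    rw [show k + (m + 1 + i + 1) - 2 = k + (i + 1) - 2 + (m + 1) by lia, Nat.add_mod_right]
  · simp only [Finset.prod_range_add]
    congr 1
    refine Finset.prod_congr rfl fun i hi => ?_
    have hi' := Finset.mem_range.1 hi
    rw [show k + (L + 1 + i + 1) - 2 = i + W * (m + 1) by lia, Nat.add_mul_mod_self_right,
      Nat.mod_eq_of_lt (by lia)]
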